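/- arXiv:2311.07219 — 2 statements merged into one kernel-verified Lean document; each statement's English description precedes it below -/
import Mathlib

section
/- Let G = (V,E) be a finite simple graph with a co-comparability ordering ≺, and let u, v ∈ V be distinct with uv ∉ E and u ≺ v. Let I_u be an independent set containing u of maximum cardinality among independent sets containing u, and let I_v be an independent set containing v of maximum cardinality among independent sets containing v. Then pos_{I_u}(u) < pos_{I_v}(v). -/
/-- An independent set (as a finset): pairwise non-adjacent vertices. -/
def IsIndep {V : Type*} (G : SimpleGraph V) (I : Finset V) : Prop :=
  ∀ u ∈ I, ∀ v ∈ I, u ≠ v → ¬ G.Adj u v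

/-- `pos_I(v) = |{u ∈ I : u ≺ v}| + 1`. -/
def posIn {V : Type*} [LinearOrder V] (I : Finset V) (v : V) : ℕ :=
  (I.filter fun u => u < v).card + 1

/-- Non-adjacency propagates across a non-adjacent pair `u < v` under a co-comparability ordering. -/
theorem not_adj_of_le_of_le {V : Type*} [LinearOrder V] {G : SimpleGraph V}
    (hco : ∀ u v w : V, u < v → v < w → ¬ G.Adj u v → ¬ G.Adj v w → ¬ G.Adj u w)
    {I J : Finset V} (hI : IsIndep G I) (hJ : IsIndep G J) {u v a b : V}
    (hu : u ∈ I) (hv : v ∈ J) (hlt : u < v) (huv : ¬ G.Adj u v)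
    (ha : a ∈ I) (hau : a ≤ u) (hb : b ∈ J) (hvb : v ≤ b) : ¬ G.Adj a b := by
  have hav : ¬ G.Adj a v := by
    rcases hau.eq_or_lt with rfl | h
    · exact huv
    · exact hco a u v h hlt (hI a ha u hu h.ne) huv
  rcases hvb.eq_or_lt with rfl | h
  · exact hav
  · exact hco a v b (hau.trans_lt hlt) h hav (hJ v hv b hb h.ne)

/-- Splicing the part of `I` up to `u` with the part of `J` from `v` on gives an independent set. -/
theorem isIndep_filter_le_union_filter_ge {V : Type*} [LinearOrder V] {G : SimpleGraph V}
    (hco : ∀ u v w : V, u < v → v < w → ¬ G.Adj u v → ¬ G.Adj v w → ¬ G.Adj u w)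
    {I J : Finset V} (hI : IsIndep G I) (hJ : IsIndep G J) {u v : V}
    (hu : u ∈ I) (hv : v ∈ J) (hlt : u < v) (huv : ¬ G.Adj u v) :
    IsIndep G (I.filter (· ≤ u) ∪ J.filter (v ≤ ·)) := by
  intro a ha b hb hab
  simp only [Finset.mem_union, Finset.mem_filter] at ha hb
  rcases ha with ⟨ha, ha'⟩ | ⟨ha, ha'⟩ <;> rcases hb with ⟨hb, hb'⟩ | ⟨hb, hb'⟩
  · exact hI a ha b hb hab
  · exact not_adj_of_le_of_le hco hI hJ hu hv hlt huv ha ha' hb hb'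
  · exact fun h => not_adj_of_le_of_le hco hI hJ hu hv hlt huv hb hb' ha ha' h.symm
  · exact hJ a ha b hb hab

/-- The position of a member `u` of `I` counts the members of `I` that are at most `u`. -/
theorem card_filter_le_eq_posIn {V : Type*} [LinearOrder V] {I : Finset V} {u : V}
    (hu : u ∈ I) : (I.filter (· ≤ u)).card = posIn I u := by
  have h : I.filter (· ≤ u) = insert u (I.filter (· < u)) := by
    ext x
    simp only [Finset.mem_filter, Finset.mem_insert, le_iff_eq_or_lt]
    aesop
  rw [h, Finset.card_insert_of_notMem (by simp), posIn]

/-- In a finite graph with a co-comparability ordering, let `u ≠ v` with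
`uv ∉ E` and `u ≺ v`, let `I_u` (resp. `I_v`) be an independent set containing `u`
(resp. `v`) of maximum cardinality among independent sets containing `u` (resp. `v`).
Then `pos_{I_u}(u) < pos_{I_v}(v)`. -/
theorem stmt14 {V : Type*} [Fintype V] [LinearOrder V] (G : SimpleGraph V)
    (hco : ∀ u v w : V, u < v → v < w → ¬ G.Adj u v → ¬ G.Adj v w → ¬ G.Adj u w)
    (u v : V) (huv : u ≠ v) (hnadj : ¬ G.Adj u v) (hlt : u < v)
    (Iu : Finset V) (hIu : IsIndep G Iu) (huIu : u ∈ Iu)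
    (hIumax : ∀ J : Finset V, IsIndep G J → u ∈ J → J.card ≤ Iu.card)
    (Iv : Finset V) (hIv : IsIndep G Iv) (hvIv : v ∈ Iv)
    (hIvmax : ∀ J : Finset V, IsIndep G J → v ∈ J → J.card ≤ Iv.card) :
    posIn Iu u < posIn Iv v := by
  have hdisj : Disjoint (Iu.filter (· ≤ u)) (Iv.filter (v ≤ ·)) :=
    Finset.disjoint_left.2 fun x hx hx' =>
      ((Finset.mem_filter.1 hx).2.trans_lt hlt).not_ge (Finset.mem_filter.1 hx').2
  have hcard := hIvmax _
    (isIndep_filter_le_union_filter_ge hco hIu hIv huIu hvIv hlt hnadj) (by simp [hvIv])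
  rw [Finset.card_union_of_disjoint hdisj, card_filter_le_eq_posIn huIu] at hcard
  have hsplit := Iv.card_filter_add_card_filter_not (· < v)
  simp only [not_lt] at hsplit
  rw [posIn.eq_def Iv]
  omega
end

section
/- Let G = (V,E) be a finite simple graph with a co-comparability ordering ≺, let α = α(G), let d be an integer with 1 ≤ d ≤ α, and let I be an independent set of G of size α − d + 1. For each v ∈ I, fix an independent set I_v containing v of maximum cardinality among all independent sets of G containing v. Then the map v ↦ pos_{I_v}(v) is an injective map from I into {1,…,α}, and consequently exactly d − 1 integers g ∈ {1,…,α} satisfy pos_{I_v}(v) ≠ g for all v ∈ I. -/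
/-- The independence number `α(G)`: the maximum size of an independent set. -/
noncomputable def indepNum {V : Type*} (G : SimpleGraph V) : ℕ :=
  sSup {n | ∃ I : Finset V, IsIndep G I ∧ I.card = n}

theorem IsIndep.card_le_indepNum {V : Type*} [Fintype V] {G : SimpleGraph V} {I : Finset V}
    (hI : IsIndep G I) : I.card ≤ indepNum G :=
  le_csSup ⟨Fintype.card V, by rintro n ⟨J, -, rfl⟩; exact J.card_le_univ⟩ ⟨I, hI, rfl⟩

/-- In a co-comparability ordering, the part of one independent set up to `u` and the part of
another from `v` on form an independent set when `u < v` are non-adjacent. -/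
theorem IsIndep.union_filter {V : Type*} [LinearOrder V] {G : SimpleGraph V}
    (hco : ∀ u v w : V, u < v → v < w → ¬ G.Adj u v → ¬ G.Adj v w → ¬ G.Adj u w)
    {A B : Finset V} (hA : IsIndep G A) (hB : IsIndep G B) {u v : V} (hu : u ∈ A) (hv : v ∈ B)
    (huv : u < v) (hadj : ¬ G.Adj u v) :
    IsIndep G ((A.filter fun x => x ≤ u) ∪ B.filter fun x => v ≤ x) := by
  have cross : ∀ a ∈ A, a ≤ u → ∀ b ∈ B, v ≤ b → ¬ G.Adj a b := by
    intro a ha hau b hb hvb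
    have hav : ¬ G.Adj a v := by
      rcases hau.eq_or_lt with rfl | h
      · exact hadj
      · exact hco a u v h huv (hA a ha u hu h.ne) hadj
    rcases hvb.eq_or_lt with rfl | h
    · exact hav
    · exact hco a v b (hau.trans_lt huv) h hav (hB v hv b hb h.ne)
  intro a ha b hb hab
  simp only [Finset.mem_union, Finset.mem_filter] at ha hb
  rcases ha with ⟨ha, hau⟩ | ⟨ha, hva⟩ <;> rcases hb with ⟨hb, hbu⟩ | ⟨hb, hvb⟩
  · exact hA a ha b hb hab
  · exact cross a ha hau b hb hvb
  · exact fun h => cross b hb hbu a ha hva h.symm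
  · exact hB a ha b hb hab

theorem posIn_eq_card_filter_le {V : Type*} [LinearOrder V] {I : Finset V} {v : V} (hv : v ∈ I) :
    posIn I v = (I.filter fun u => u ≤ v).card := by
  have h : (I.filter fun u => u ≤ v) = insert v (I.filter fun u => u < v) := by
    ext x
    simp only [Finset.mem_filter, Finset.mem_insert, le_iff_eq_or_lt]
    grind
  rw [h, Finset.card_insert_of_notMem (by simp), posIn]

theorem posIn_lt_posIn {V : Type*} [LinearOrder V] {G : SimpleGraph V}
    (hco : ∀ u v w : V, u < v → v < w → ¬ G.Adj u v → ¬ G.Adj v w → ¬ G.Adj u w)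
    {A B : Finset V} (hA : IsIndep G A) (hB : IsIndep G B) {u v : V} (hu : u ∈ A) (hv : v ∈ B)
    (hmax : ∀ J : Finset V, IsIndep G J → v ∈ J → J.card ≤ B.card)
    (huv : u < v) (hadj : ¬ G.Adj u v) : posIn A u < posIn B v := by
  have hle := hmax _ (hA.union_filter hco hB hu hv huv hadj) (by simp [hv])
  rw [Finset.card_union_of_disjoint] at hle
  · have hsplit := B.card_filter_add_card_filter_not (fun x => x < v)
    simp only [not_lt] at hsplit
    rw [posIn_eq_card_filter_le hu, posIn]
    lia
  · rw [Finset.disjoint_left]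
    intro x hxA hxB
    exact absurd (((Finset.mem_filter.1 hxB).2.trans (Finset.mem_filter.1 hxA).2).trans_lt huv)
      (lt_irrefl v)

/-- In a finite graph with a co-comparability ordering, with
`1 ≤ d ≤ α(G)`, let `I` be an independent set of size `α(G) - d + 1`, and for each
`v ∈ I` fix an independent set `f v` containing `v` of maximum cardinality among
independent sets containing `v`. Then `v ↦ pos_{f v}(v)` is injective on `I`, takes
values in `{1, …, α(G)}`, and exactly `d - 1` integers `g ∈ {1, …, α(G)}` are avoided
by it. -/
theorem stmt18 {V : Type*} [Fintype V] [LinearOrder V] (G : SimpleGraph V)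
    (hco : ∀ u v w : V, u < v → v < w → ¬ G.Adj u v → ¬ G.Adj v w → ¬ G.Adj u w)
    (d : ℕ) (hd1 : 1 ≤ d) (hdα : d ≤ indepNum G)
    (I : Finset V) (hI : IsIndep G I) (hIcard : I.card = indepNum G - d + 1)
    (f : V → Finset V)
    (hf : ∀ v ∈ I, IsIndep G (f v) ∧ v ∈ f v ∧
      ∀ J : Finset V, IsIndep G J → v ∈ J → J.card ≤ (f v).card) :
    Set.InjOn (fun v => posIn (f v) v) ↑I ∧
    (∀ v ∈ I, posIn (f v) v ∈ Finset.Icc 1 (indepNum G)) ∧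
    ((Finset.Icc 1 (indepNum G)).filter
        (fun g => ∀ v ∈ I, posIn (f v) v ≠ g)).card = d - 1 := by
  have hinj : Set.InjOn (fun v => posIn (f v) v) ↑I := by
    refine StrictMonoOn.injOn fun u hu v hv huv => ?_
    obtain ⟨hA, huA, -⟩ := hf u hu
    obtain ⟨hB, hvB, hmax⟩ := hf v hv
    exact posIn_lt_posIn hco hA hB huA hvB hmax huv (hI u hu v hv huv.ne)
  have hrange : ∀ v ∈ I, posIn (f v) v ∈ Finset.Icc 1 (indepNum G) := by
    intro v hv
    obtain ⟨hA, hvA, -⟩ := hf v hv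
    refine Finset.mem_Icc.2 ⟨Nat.le_add_left _ _, ?_⟩
    rw [posIn_eq_card_filter_le hvA]
    exact (Finset.card_filter_le _ _).trans hA.card_le_indepNum
  refine ⟨hinj, hrange, ?_⟩
  have hcompl : (Finset.Icc 1 (indepNum G)).filter (fun g => ∀ v ∈ I, posIn (f v) v ≠ g) =
      Finset.Icc 1 (indepNum G) \ I.image (fun v => posIn (f v) v) := by
    ext g
    simp
  rw [hcompl, Finset.card_sdiff_of_subset (Finset.image_subset_iff.2 hrange),
    Finset.card_image_of_injOn hinj, Nat.card_Icc, hIcard]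
  lia
end
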